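/- Let n ≥ 1 be an integer and let γ_1, …, γ_{n−1} ∈ (0,1] satisfy the symmetry condition γ_i = γ_{n−i} for all 0 < i < n. For λ ∈ [0,1), define S_n(λ) = ∑_{i=1}^{n−1} (1/γ_i)(1 − λ^{n−i}) and, for 0 ≤ k ≤ n, E_k(λ) = ((1+λ)/(1−λ)) · ( S_n(λ) (1−λ^k)/(1−λ^n) − ∑_{i=1}^{k−1} (1/γ_i)(1 − λ^{k−i}) ). Then for every 0 ≤ k ≤ n, the function λ ↦ E_k(λ) + E_{n−k}(λ) is monotonically nondecreasing on [0,1). -/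

import Mathlib

open Set

namespace GamblersRuin

/-- With `x = exp (-2t)`, this is `tanh (j t)`. -/
noncomputable def tanhPow (j : ℕ) (x : ℝ) : ℝ := (1 - x ^ j) / (1 + x ^ j)

lemma tanhPow_nonneg (j : ℕ) {x : ℝ} (hx : x ∈ Ico (0 : ℝ) 1) : 0 ≤ tanhPow j x :=
  div_nonneg (sub_nonneg.2 (pow_le_one₀ hx.1 hx.2.le)) (by have := pow_nonneg hx.1 j; linarith)

lemma tanhPow_pos {j : ℕ} (hj : 1 ≤ j) {x : ℝ} (hx : x ∈ Ico (0 : ℝ) 1) : 0 < tanhPow j x :=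
  div_pos (sub_pos.2 (pow_lt_one₀ hx.1 hx.2 (by omega)))
    (by have := pow_nonneg hx.1 j; linarith)

lemma tanhPow_le_one (j : ℕ) {x : ℝ} (hx : x ∈ Ico (0 : ℝ) 1) : tanhPow j x ≤ 1 := by
  have := pow_nonneg hx.1 j
  rw [tanhPow, div_le_one (by linarith)]
  linarith

lemma tanhPow_antitone (j : ℕ) {x y : ℝ} (hx : x ∈ Ico (0 : ℝ) 1) (hxy : x ≤ y) :
    tanhPow j y ≤ tanhPow j x := by
  have h0 := pow_nonneg hx.1 j
  have h1 := pow_le_pow_left₀ hx.1 hxy j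
  rw [tanhPow, tanhPow, div_le_div_iff₀ (by linarith) (by linarith)]
  nlinarith

lemma tanhPow_one_pos {x : ℝ} (hx : x ∈ Ico (0 : ℝ) 1) : 0 < tanhPow 1 x :=
  tanhPow_pos le_rfl hx

/-- The addition formula for `tanh`, in the form of a recursion for `tanh (j t) / tanh t`. -/
lemma tanhPow_succ_div (j : ℕ) {x : ℝ} (hx : x ∈ Ico (0 : ℝ) 1) :
    tanhPow (j + 1) x / tanhPow 1 x =
      (tanhPow j x / tanhPow 1 x + 1) /
        (1 + tanhPow j x / tanhPow 1 x * tanhPow 1 x ^ 2) := by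
  have h0 := pow_nonneg hx.1 j
  have h1 : x ^ j ≤ 1 := pow_le_one₀ hx.1 hx.2.le
  have hu := tanhPow_one_pos hx
  have hK := tanhPow_nonneg j hx
  have e : tanhPow j x / tanhPow 1 x * tanhPow 1 x ^ 2 = tanhPow j x * tanhPow 1 x := by
    field_simp
  have hd : 0 < 1 + tanhPow j x * tanhPow 1 x := by positivity
  have hsucc : tanhPow (j + 1) x =
      (tanhPow j x + tanhPow 1 x) / (1 + tanhPow j x * tanhPow 1 x) := by
    rw [eq_div_iff hd.ne']
    have a1 : 1 + x ^ j ≠ 0 := by linarith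
    have a2 : 1 + x ≠ 0 := by linarith [hx.1]
    have a3 : 1 + x ^ j * x ≠ 0 := by nlinarith [hx.1]
    simp only [tanhPow, pow_succ]
    field_simp
    ring
  rw [e, hsucc]
  field_simp

lemma tanhPow_div_monotone (j : ℕ) {x y : ℝ} (hx : x ∈ Ico (0 : ℝ) 1) (hy : y ∈ Ico (0 : ℝ) 1)
    (hxy : x ≤ y) : tanhPow j x / tanhPow 1 x ≤ tanhPow j y / tanhPow 1 y := by
  induction j with
  | zero => simp [tanhPow]
  | succ j ih =>
    rw [tanhPow_succ_div j hx, tanhPow_succ_div j hy]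
    have hp := div_nonneg (tanhPow_nonneg j hx) (tanhPow_nonneg 1 hx)
    have hq := div_nonneg (tanhPow_nonneg j hy) (tanhPow_nonneg 1 hy)
    have hu := tanhPow_nonneg 1 hx
    have hv := tanhPow_nonneg 1 hy
    have hu1 := tanhPow_le_one 1 hx
    have huv := tanhPow_antitone 1 hx hxy
    generalize tanhPow j x / tanhPow 1 x = p at *
    generalize tanhPow j y / tanhPow 1 y = q at *
    generalize tanhPow 1 x = u at *
    generalize tanhPow 1 y = v at *
    have hsq : v ^ 2 ≤ u ^ 2 := pow_le_pow_left₀ hv huv 2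
    have hsq1 : u ^ 2 ≤ 1 := pow_le_one₀ hu hu1
    rw [div_le_div_iff₀ (by positivity) (by positivity)]
    nlinarith [mul_le_mul_of_nonneg_left hsq (mul_nonneg hp hq),
      mul_le_mul_of_nonneg_left hsq hq, mul_le_mul_of_nonneg_left hsq1 (sub_nonneg.2 ih)]

/-- With `x = exp (-2t)`, twice `coth t * sinh (p t) * sinh (q t) / sinh ((p + q) t)`. -/
noncomputable def sinhPart (p q : ℕ) (x : ℝ) : ℝ :=
  (1 + x) / (1 - x) * (2 * (1 - x ^ p) * (1 - x ^ q) / (1 - x ^ (p + q)))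

lemma sinhPart_eq {p q : ℕ} (hp : 1 ≤ p) (hq : 1 ≤ q) {x : ℝ} (hx : x ∈ Ico (0 : ℝ) 1) :
    sinhPart p q x =
      4 / ((tanhPow p x / tanhPow 1 x)⁻¹ + (tanhPow q x / tanhPow 1 x)⁻¹) := by
  have p0 := pow_nonneg hx.1 p
  have q0 := pow_nonneg hx.1 q
  have p1 : x ^ p < 1 := pow_lt_one₀ hx.1 hx.2 (by omega)
  have q1 : x ^ q < 1 := pow_lt_one₀ hx.1 hx.2 (by omega)
  have hs : x ^ p * x ^ q < 1 := by nlinarith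
  have e1 : 0 < 1 - x := by linarith [hx.2]
  have e2 : 0 < 1 + x := by linarith [hx.1]
  simp only [sinhPart, tanhPow, pow_one, pow_add]
  generalize x ^ p = P at *
  generalize x ^ q = Q at *
  have a1 : 0 < 1 - P := by linarith
  have a2 : 0 < 1 - Q := by linarith
  have a3 : 0 < 1 + P := by linarith
  have a4 : 0 < 1 + Q := by linarith
  have a5 : 0 < 1 - P * Q := by linarith
  have e : ((1 - P) / (1 + P) / ((1 - x) / (1 + x)))⁻¹ + ((1 - Q) / (1 + Q) / ((1 - x) / (1 + x)))⁻¹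
      = (1 - x) * (2 * (1 - P * Q)) / ((1 + x) * ((1 - P) * (1 - Q))) := by
    field_simp
    ring
  rw [e]
  field_simp
  norm_num

lemma sinhPart_monotone {p q : ℕ} (hp : 1 ≤ p) (hq : 1 ≤ q) {x y : ℝ}
    (hx : x ∈ Ico (0 : ℝ) 1) (hy : y ∈ Ico (0 : ℝ) 1) (hxy : x ≤ y) :
    sinhPart p q x ≤ sinhPart p q y := by
  rw [sinhPart_eq hp hq hx, sinhPart_eq hp hq hy]
  have hpx := div_pos (tanhPow_pos hp hx) (tanhPow_one_pos hx)
  have hqx := div_pos (tanhPow_pos hq hx) (tanhPow_one_pos hx)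
  have hpy := div_pos (tanhPow_pos hp hy) (tanhPow_one_pos hy)
  have hqy := div_pos (tanhPow_pos hq hy) (tanhPow_one_pos hy)
  have h1 := tanhPow_div_monotone p hx hy hxy
  have h2 := tanhPow_div_monotone q hx hy hxy
  gcongr

/-- The prefactor of the part of `orbitCoeff` depending on `a` and `b` individually. -/
noncomputable def coshFactor (k m : ℕ) (x : ℝ) : ℝ :=
  (1 + x) / (1 - x) * ((1 - x ^ k) ^ 2 / (1 - x ^ (k + (k + m))))

lemma coshFactor_nonneg (k m : ℕ) {x : ℝ} (hx : x ∈ Ico (0 : ℝ) 1) : 0 ≤ coshFactor k m x := by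
  have h1 : 0 ≤ 1 - x := by linarith [hx.2]
  have h2 : 0 ≤ 1 + x := by linarith [hx.1]
  have h3 : 0 ≤ 1 - x ^ (k + (k + m)) := sub_nonneg.2 (pow_le_one₀ hx.1 hx.2.le)
  rw [coshFactor]
  positivity

lemma extremal_eq {k : ℕ} (hk : 1 ≤ k) (m : ℕ) {x : ℝ} (hx : x ∈ Ico (0 : ℝ) 1) :
    sinhPart k (k + m) x + coshFactor k m x * (1 + x ^ m) =
      4 * (tanhPow k x / tanhPow 1 x) *
        ((2 * tanhPow k x + tanhPow m x) /
          (2 * tanhPow k x + tanhPow m x + tanhPow k x ^ 2 * tanhPow m x)) := by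
  have p0 := pow_nonneg hx.1 k
  have q0 := pow_nonneg hx.1 m
  have p1 : x ^ k < 1 := pow_lt_one₀ hx.1 hx.2 (by omega)
  have q1 : x ^ m ≤ 1 := pow_le_one₀ hx.1 hx.2.le
  have e1 : 0 < 1 - x := by linarith [hx.2]
  have e2 : 0 < 1 + x := by linarith [hx.1]
  simp only [sinhPart, coshFactor, tanhPow, pow_one, pow_add]
  generalize x ^ k = P at *
  generalize x ^ m = Q at *
  have a1 : 0 < 1 - P := by linarith
  have a3 : 0 < 1 + P := by linarith
  have a4 : 0 < 1 + Q := by linarith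
  have a5 : 0 < 1 - P * (P * Q) := by nlinarith [mul_nonneg p0 q0]
  have n1 : 2 * ((1 - P) / (1 + P)) + (1 - Q) / (1 + Q)
      = (2 * (1 - P) * (1 + Q) + (1 - Q) * (1 + P)) / ((1 + P) * (1 + Q)) := by
    field_simp
  have n2 : 2 * ((1 - P) / (1 + P)) + (1 - Q) / (1 + Q)
        + ((1 - P) / (1 + P)) ^ 2 * ((1 - Q) / (1 + Q))
      = 4 * (1 - P * (P * Q)) / ((1 + P) ^ 2 * (1 + Q)) := by
    field_simp
    ring
  rw [n2, n1]
  field_simp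
  ring

lemma extremal_monotone {k : ℕ} (hk : 1 ≤ k) (m : ℕ) {x y : ℝ}
    (hx : x ∈ Ico (0 : ℝ) 1) (hy : y ∈ Ico (0 : ℝ) 1) (hxy : x ≤ y) :
    sinhPart k (k + m) x + coshFactor k m x * (1 + x ^ m) ≤
      sinhPart k (k + m) y + coshFactor k m y * (1 + y ^ m) := by
  rw [extremal_eq hk m hx, extremal_eq hk m hy]
  have hK := tanhPow_pos hk hx
  have hL := tanhPow_pos hk hy
  have hM := tanhPow_nonneg m hx
  have hN := tanhPow_nonneg m hy
  have hLK := tanhPow_antitone k hx hxy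
  have hNM := tanhPow_antitone m hx hxy
  have hdiv := tanhPow_div_monotone k hx hy hxy
  have hdiv0 := div_nonneg (tanhPow_nonneg k hy) (tanhPow_nonneg 1 hy)
  refine mul_le_mul (by linarith) ?_ (by positivity) (by linarith)
  generalize tanhPow k x = K at *
  generalize tanhPow k y = L at *
  generalize tanhPow m x = M at *
  generalize tanhPow m y = N at *
  rw [div_le_div_iff₀ (by positivity) (by positivity)]
  have h1 : K * L * (L * N) ≤ K * L * (K * M) := by gcongr
  have h2 : M * N * L ^ 2 ≤ M * N * K ^ 2 := by gcongr
  nlinarith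

/-- The coefficient of `1 / γ i` in the sum of absorption times over the four pairs obtained from
`(k, i)` by reflection, where `i = k + a` and `n = 2 * k + a + b`. -/
noncomputable def orbitCoeff (k a b : ℕ) (x : ℝ) : ℝ :=
  sinhPart k (k + (a + b)) x + coshFactor k (a + b) x * (x ^ a + x ^ b)

lemma orbitCoeff_monotone {k : ℕ} (hk : 1 ≤ k) (a b : ℕ) {x y : ℝ}
    (hx : x ∈ Ico (0 : ℝ) 1) (hy : y ∈ Ico (0 : ℝ) 1) (hxy : x ≤ y) :
    orbitCoeff k a b x ≤ orbitCoeff k a b y := by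
  have hA : sinhPart k (k + (a + b)) x ≤ sinhPart k (k + (a + b)) y :=
    sinhPart_monotone hk (by omega) hx hy hxy
  have hm := extremal_monotone hk (a + b) hx hy hxy
  have hc := coshFactor_nonneg k (a + b) hx
  have hd := coshFactor_nonneg k (a + b) hy
  simp only [orbitCoeff]
  rw [pow_add, pow_add] at hm
  have a0 := pow_nonneg hx.1 a
  have b0 := pow_nonneg hx.1 b
  have a1 := pow_le_pow_left₀ hx.1 hxy a
  have b1 := pow_le_pow_left₀ hx.1 hxy b
  have a2 : y ^ a ≤ 1 := pow_le_one₀ hy.1 hy.2.le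
  have b2 : y ^ b ≤ 1 := pow_le_one₀ hy.1 hy.2.le
  generalize coshFactor k (a + b) x = c at *
  generalize coshFactor k (a + b) y = d at *
  generalize sinhPart k (k + (a + b)) x = A at *
  generalize sinhPart k (k + (a + b)) y = B at *
  generalize x ^ a = p at *
  generalize x ^ b = q at *
  generalize y ^ a = r at *
  generalize y ^ b = s at *
  by_cases h : c * (p + q) ≤ d * (r + s)
  · linarith
  · have hlt := not_le.1 h
    have hds : 0 ≤ d * (r + s) := mul_nonneg hd (by linarith)
    have hpq : 0 < p + q := by
      by_contra h0
      have : p + q = 0 := by linarith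
      rw [this] at hlt
      linarith
    have key : (1 - r) * (1 - s) * (p + q) ≤ (1 - p) * (1 - q) * (r + s) := by
      have hr : 0 ≤ 1 - r := by linarith
      have hs : 0 ≤ 1 - s := by linarith
      have hp : 0 ≤ 1 - p := by linarith
      have hq : 0 ≤ 1 - q := by linarith
      gcongr
    have hpq' : 0 ≤ (1 - p) * (1 - q) := mul_nonneg (by linarith) (by linarith)
    have hdc : d * ((1 - r) * (1 - s)) ≤ c * ((1 - p) * (1 - q)) := by
      refine le_of_mul_le_mul_right ?_ hpq
      calc d * ((1 - r) * (1 - s)) * (p + q) = d * ((1 - r) * (1 - s) * (p + q)) := by ring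
        _ ≤ d * ((1 - p) * (1 - q) * (r + s)) := by gcongr
        _ = (1 - p) * (1 - q) * (d * (r + s)) := by ring
        _ ≤ (1 - p) * (1 - q) * (c * (p + q)) := by gcongr
        _ = c * ((1 - p) * (1 - q)) * (p + q) := by ring
    linarith

/-- The mean time spent in `i` before absorption, started from `k`, divided by `1 / γ i`. -/
noncomputable def green (n k i : ℕ) (x : ℝ) : ℝ :=
  (1 + x) / (1 - x) * ((1 - x ^ (n - i)) * (1 - x ^ k) / (1 - x ^ n) - (1 - x ^ (k - i)))

/-- `green` summed over the reflections of `k` and `i`. -/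
noncomputable def greenOrbit (n k i : ℕ) (x : ℝ) : ℝ :=
  green n k i x + green n k (n - i) x + (green n (n - k) i x + green n (n - k) (n - i) x)

lemma greenOrbit_reflect_left {n k : ℕ} (hk : k ≤ n) (i : ℕ) (x : ℝ) :
    greenOrbit n (n - k) i x = greenOrbit n k i x := by
  rw [greenOrbit, greenOrbit, Nat.sub_sub_self hk, add_comm]

lemma greenOrbit_reflect_right {n i : ℕ} (hi : i ≤ n) (k : ℕ) (x : ℝ) :
    greenOrbit n k (n - i) x = greenOrbit n k i x := by
  rw [greenOrbit, greenOrbit, Nat.sub_sub_self hi]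
  ring

lemma greenOrbit_eq_of_le {k : ℕ} (hk : 1 ≤ k) (a b : ℕ) {x : ℝ} (hx : x ∈ Ico (0 : ℝ) 1) :
    greenOrbit (2 * k + a + b) k (k + a) x = orbitCoeff k a b x := by
  have hn : 1 - x ^ (k + (k + (a + b))) ≠ 0 :=
    (sub_pos.2 (pow_lt_one₀ hx.1 hx.2 (by omega))).ne'
  have e : 1 - x ≠ 0 := (sub_pos.2 hx.2).ne'
  rw [greenOrbit, show 2 * k + a + b - (k + a) = k + b by omega,
    show 2 * k + a + b - k = k + a + b by omega]
  simp only [green, orbitCoeff, sinhPart, coshFactor]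
  rw [show 2 * k + a + b - (k + a) = k + b by omega,
    show 2 * k + a + b - (k + b) = k + a by omega,
    show k - (k + a) = 0 by omega, show k - (k + b) = 0 by omega,
    show k + a + b - (k + a) = b by omega, show k + a + b - (k + b) = a by omega,
    show 2 * k + a + b = k + (k + (a + b)) by omega]
  simp only [pow_add, pow_zero] at hn ⊢
  generalize x ^ k = P at *
  generalize x ^ a = Q at *
  generalize x ^ b = R at *
  generalize hD : 1 - P * (P * (Q * R)) = D at *
  field_simp
  rw [← hD]
  ring

lemma greenOrbit_eq_of_ge {i : ℕ} (hi : 1 ≤ i) (a b : ℕ) {x : ℝ} (hx : x ∈ Ico (0 : ℝ) 1) :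
    greenOrbit (2 * i + a + b) (i + a) i x = orbitCoeff i a b x := by
  have hn : 1 - x ^ (i + (i + (a + b))) ≠ 0 :=
    (sub_pos.2 (pow_lt_one₀ hx.1 hx.2 (by omega))).ne'
  have e : 1 - x ≠ 0 := (sub_pos.2 hx.2).ne'
  rw [greenOrbit, show 2 * i + a + b - (i + a) = i + b by omega,
    show 2 * i + a + b - i = i + a + b by omega]
  simp only [green, orbitCoeff, sinhPart, coshFactor]
  rw [show 2 * i + a + b - i = i + a + b by omega,
    show 2 * i + a + b - (i + a + b) = i by omega,
    show i + a - (i + a + b) = 0 by omega, show i + b - (i + a + b) = 0 by omega,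
    show i + a - i = a by omega, show i + b - i = b by omega,
    show 2 * i + a + b = i + (i + (a + b)) by omega]
  simp only [pow_add, pow_zero] at hn ⊢
  generalize x ^ i = P at *
  generalize x ^ a = Q at *
  generalize x ^ b = R at *
  generalize hD : 1 - P * (P * (Q * R)) = D at *
  field_simp
  rw [← hD]
  ring

lemma greenOrbit_zero {n i : ℕ} (hi : 1 ≤ i) (hin : i < n) {x : ℝ} (hx : x ∈ Ico (0 : ℝ) 1) :
    greenOrbit n 0 i x = 0 := by
  have hn : 1 - x ^ n ≠ 0 := (sub_pos.2 (pow_lt_one₀ hx.1 hx.2 (by omega))).ne'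
  simp [greenOrbit, green, mul_div_assoc, div_self hn]

lemma greenOrbit_monotone {n k i : ℕ} (hk : k ≤ n) (hi : 1 ≤ i) (hin : i < n) {x y : ℝ}
    (hx : x ∈ Ico (0 : ℝ) 1) (hy : y ∈ Ico (0 : ℝ) 1) (hxy : x ≤ y) :
    greenOrbit n k i x ≤ greenOrbit n k i y := by
  wlog hk2 : 2 * k ≤ n generalizing k
  · have := this (k := n - k) (by omega) (by omega)
    rwa [greenOrbit_reflect_left hk, greenOrbit_reflect_left hk] at this
  wlog hi2 : 2 * i ≤ n generalizing i
  · have := this (i := n - i) (by omega) (by omega) (by omega)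
    rwa [greenOrbit_reflect_right hin.le, greenOrbit_reflect_right hin.le] at this
  rcases Nat.eq_zero_or_pos k with rfl | hk0
  · rw [greenOrbit_zero hi hin hx, greenOrbit_zero hi hin hy]
  rcases le_total k i with h | h
  · obtain ⟨a, rfl⟩ := Nat.exists_eq_add_of_le h
    obtain ⟨b, rfl⟩ := Nat.exists_eq_add_of_le (show 2 * k + a ≤ n by omega)
    rw [greenOrbit_eq_of_le hk0 a b hx, greenOrbit_eq_of_le hk0 a b hy]
    exact orbitCoeff_monotone hk0 a b hx hy hxy
  · obtain ⟨a, rfl⟩ := Nat.exists_eq_add_of_le h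
    obtain ⟨b, rfl⟩ := Nat.exists_eq_add_of_le (show 2 * i + a ≤ n by omega)
    rw [greenOrbit_eq_of_ge hi a b hx, greenOrbit_eq_of_ge hi a b hy]
    exact orbitCoeff_monotone hi a b hx hy hxy

lemma sum_green {n k : ℕ} (hk : k ≤ n) (g : ℕ → ℝ) (x : ℝ) :
    (1 + x) / (1 - x) *
      ((∑ i ∈ Finset.Ico 1 n, g i * (1 - x ^ (n - i))) * (1 - x ^ k) / (1 - x ^ n) -
        ∑ i ∈ Finset.Ico 1 k, g i * (1 - x ^ (k - i))) =
      ∑ i ∈ Finset.Ico 1 n, g i * green n k i x := by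
  have h : ∑ i ∈ Finset.Ico 1 k, g i * (1 - x ^ (k - i)) =
      ∑ i ∈ Finset.Ico 1 n, g i * (1 - x ^ (k - i)) := by
    refine Finset.sum_subset (Finset.Ico_subset_Ico_right hk) fun i hi hik => ?_
    rw [Finset.mem_Ico] at hi hik
    rw [show k - i = 0 by omega]
    simp
  rw [h, Finset.sum_mul, Finset.sum_div, ← Finset.sum_sub_distrib, Finset.mul_sum]
  refine Finset.sum_congr rfl fun i _ => ?_
  rw [green]
  ring

lemma sum_reflect (n : ℕ) (f : ℕ → ℝ) :
    ∑ i ∈ Finset.Ico 1 n, f (n - i) = ∑ i ∈ Finset.Ico 1 n, f i := by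
  refine Finset.sum_nbij' (fun i => n - i) (fun i => n - i) ?_ ?_ ?_ ?_ fun _ _ => rfl
  all_goals
    intro i hi
    simp only [Finset.mem_Ico] at hi ⊢
    omega

lemma two_mul_sum_green {n : ℕ} (k : ℕ) {g : ℕ → ℝ} (hg : ∀ i, 0 < i → i < n → g i = g (n - i))
    (x : ℝ) :
    2 * (∑ i ∈ Finset.Ico 1 n, g i * green n k i x +
        ∑ i ∈ Finset.Ico 1 n, g i * green n (n - k) i x) =
      ∑ i ∈ Finset.Ico 1 n, g i * greenOrbit n k i x := by
  have h : ∀ j, ∑ i ∈ Finset.Ico 1 n, g i * green n j (n - i) x =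
      ∑ i ∈ Finset.Ico 1 n, g i * green n j i x := fun j => by
    rw [← sum_reflect n fun i => g i * green n j i x]
    refine Finset.sum_congr rfl fun i hi => ?_
    rw [Finset.mem_Ico] at hi
    rw [hg i hi.1 hi.2]
  simp only [greenOrbit, mul_add, Finset.sum_add_distrib, h]
  ring

end GamblersRuin

open GamblersRuin in

/-- Monotonicity of the symmetrised mean absorption time of the gambler's ruin with
symmetric delays: with `γ_i = γ_{n−i}`, for every `0 ≤ k ≤ n` the function
`λ ↦ E_k(λ) + E_{n−k}(λ)` is monotonically nondecreasing on `[0, 1)`. -/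
theorem stmt_19 (n : ℕ) (hn : 1 ≤ n)
    (γ : ℕ → ℝ) (hγ : ∀ i, 0 < i → i < n → γ i ∈ Set.Ioc (0 : ℝ) 1)
    (hsym : ∀ i, 0 < i → i < n → γ i = γ (n - i))
    (Sn : ℝ → ℝ)
    (hSn : ∀ l, Sn l = ∑ i ∈ Finset.Ico 1 n, (1 / γ i) * (1 - l ^ (n - i)))
    (E : ℝ → ℕ → ℝ)
    (hE : ∀ l k, E l k = ((1 + l) / (1 - l)) *
      (Sn l * (1 - l ^ k) / (1 - l ^ n) -
        ∑ i ∈ Finset.Ico 1 k, (1 / γ i) * (1 - l ^ (k - i))))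
    (k : ℕ) (hk : k ≤ n) :
    MonotoneOn (fun l : ℝ => E l k + E l (n - k)) (Set.Ico 0 1) := by
  intro x hx y hy hxy
  have hEsum : ∀ l, 2 * (E l k + E l (n - k)) =
      ∑ i ∈ Finset.Ico 1 n, 1 / γ i * greenOrbit n k i l := fun l => by
    rw [← two_mul_sum_green k fun i hi hin => by rw [hsym i hi hin], hE, hE, hSn,
      sum_green hk, sum_green (Nat.sub_le n k)]
  have hle : 2 * (E x k + E x (n - k)) ≤ 2 * (E y k + E y (n - k)) := by
    rw [hEsum, hEsum]
    refine Finset.sum_le_sum fun i hi => ?_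
    rw [Finset.mem_Ico] at hi
    exact mul_le_mul_of_nonneg_left (greenOrbit_monotone hk hi.1 hi.2 hx hy hxy)
      (one_div_nonneg.2 (hγ i hi.1 hi.2).1.le)
  exact le_of_mul_le_mul_left hle two_pos
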